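/- arXiv:0805.1390 — 2 statements merged into one kernel-verified Lean document; each statement's English description precedes it below -/
import Mathlib

section
/- Let A be an n × n positive semidefinite real matrix with nonzero trace, and let U be a random vector distributed as N(0, (1/n)·I_n). Then for any α > 0, the probability that Uᵀ A U < α · E[Uᵀ A U] is at most e^{−((1/2) − α)/2}. -/
open MeasureTheory ProbabilityTheory Matrix
open scoped NNReal

/-- The distribution `N(0, (1/n)·I_n)` on `ℝ^n`: `n` independent coordinates, each
Gaussian with mean `0` and variance `1/n`. -/
noncomputable def gaussPi (n : ℕ) : Measure (Fin n → ℝ) :=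
  Measure.pi fun _ => gaussianReal 0 (n : ℝ≥0)⁻¹

lemma map_weighted_sum_pi_gaussianReal {ι : Type*} [Fintype ι] (v : ℝ≥0) (b : ι → ℝ) :
    (Measure.pi fun _ : ι => gaussianReal 0 v).map (fun u => ∑ i, b i * u i) =
      gaussianReal 0 ((∑ i, ‖b i‖₊ ^ 2) * v) := by
  have hpi : (Measure.pi fun _ : ι => gaussianReal 0 v).map (fun u i => b i * u i) =
      Measure.pi fun i => gaussianReal 0 (‖b i‖₊ ^ 2 * v) := by
    have hmap (i : ι) : (gaussianReal 0 v).map (b i * ·) =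
        gaussianReal 0 (‖b i‖₊ ^ 2 * v) := by
      rw [gaussianReal_map_const_mul, mul_zero]
      congr 2
      ext
      simp
    have (i : ι) : SigmaFinite ((gaussianReal 0 v).map (b i * ·)) := by
      rw [hmap]; infer_instance
    rw [Measure.pi_map_pi (f := fun i x => b i * x) (fun i => by fun_prop)]
    simp_rw [hmap]
  have hcomp : (fun u : ι → ℝ => ∑ i, b i * u i) =
      (fun p : ι → ℝ => ∑ i, p i) ∘ fun u i => b i * u i := rfl
  rw [hcomp, ← Measure.map_map (by fun_prop) (by fun_prop), hpi]
  have : IsProbabilityMeasure ((Measure.pi fun i => gaussianReal 0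
      (‖b i‖₊ ^ 2 * v)).map fun p : ι → ℝ => ∑ i, p i) :=
    Measure.isProbabilityMeasure_map (by fun_prop)
  refine Measure.ext_of_charFun ?_
  rw [charFun_map_sum_pi_eq_prod]
  ext t
  simp only [Finset.prod_apply, charFun_gaussianReal, ← Complex.exp_sum]
  congr 1
  simp [Finset.sum_mul, Finset.sum_div]

lemma integral_exp_neg_sq_div_gaussianReal {v : ℝ≥0} (hv : v ≠ 0) :
    ∫ x, Real.exp (-(x ^ 2 / (2 * v))) ∂gaussianReal 0 v = (√2)⁻¹ := by
  have hv' : (0 : ℝ) < v := by positivity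
  rw [integral_gaussianReal_eq_integral_smul hv]
  have h (x : ℝ) : gaussianPDFReal 0 v x • Real.exp (-(x ^ 2 / (2 * v))) =
      (√(2 * Real.pi * v))⁻¹ * Real.exp (-(1 / (v : ℝ)) * x ^ 2) := by
    rw [gaussianPDFReal, smul_eq_mul, mul_assoc, ← Real.exp_add]
    congr 2
    field_simp
    ring
  simp_rw [h]
  rw [integral_const_mul, integral_gaussian, mul_assoc 2, Real.sqrt_mul zero_le_two,
    div_div_eq_mul_div, div_one, mul_inv, mul_assoc, inv_mul_cancel₀ (by positivity), mul_one]

lemma integral_exp_neg_sq_weighted_sum {ι : Type*} [Fintype ι] {v : ℝ≥0} (hv : v ≠ 0)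
    (b : ι → ℝ) (hb : ∑ i, b i ^ 2 ≠ 0) :
    ∫ u, Real.exp (-((∑ i, b i * u i) ^ 2 / (2 * ((∑ i, b i ^ 2) * v))))
      ∂(Measure.pi fun _ : ι => gaussianReal 0 v) = (√2)⁻¹ := by
  set w : ℝ≥0 := (∑ i, ‖b i‖₊ ^ 2) * v with hw
  have hcoe : (w : ℝ) = (∑ i, b i ^ 2) * v := by simp [hw]
  have hw0 : w ≠ 0 := by
    rw [← NNReal.coe_ne_zero, hcoe]
    exact mul_ne_zero hb (NNReal.coe_ne_zero.2 hv)
  rw [← hcoe, ← integral_exp_neg_sq_div_gaussianReal hw0, hw,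
    ← map_weighted_sum_pi_gaussianReal, integral_map
      (Finset.measurable_sum _ fun i _ => by fun_prop).aemeasurable
      (Measurable.aestronglyMeasurable (by fun_prop))]

lemma inv_sqrt_two_le_exp : (√2)⁻¹ ≤ Real.exp (-(1 / 4)) := by
  rw [Real.exp_neg]
  refine inv_anti₀ (Real.exp_pos _) (Real.le_sqrt_of_sq_le ?_)
  rw [← Real.exp_nat_mul, ← Real.le_log_iff_exp_le zero_lt_two]
  have := Real.log_two_gt_d9
  norm_num at this ⊢
  linarith

/-- Jensen's inequality applied to a convex combination of squared Gaussian linear forms. -/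
lemma integral_exp_neg_sum_sq_le {ι κ : Type*} [Fintype ι] [Fintype κ] {v : ℝ≥0} (hv : v ≠ 0)
    (B : κ → ι → ℝ) (hB : 0 < ∑ k, ∑ i, B k i ^ 2) :
    ∫ u, Real.exp (-((∑ k, (∑ i, B k i * u i) ^ 2) / (2 * ((∑ k, ∑ i, B k i ^ 2) * v))))
      ∂(Measure.pi fun _ : ι => gaussianReal 0 v) ≤ (√2)⁻¹ := by
  have hv' : (0 : ℝ) < v := by positivity
  set T := ∑ k, ∑ i, B k i ^ 2 with hT
  set s : κ → ℝ := fun k => ∑ i, B k i ^ 2 with hs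
  have hs0 (k : κ) : 0 ≤ s k := Finset.sum_nonneg fun i _ => sq_nonneg _
  have hint {c : (ι → ℝ) → ℝ} (hc : Measurable c) (hc0 : ∀ u, 0 ≤ c u) :
      Integrable (fun u => Real.exp (-(c u))) (Measure.pi fun _ : ι => gaussianReal 0 v) :=
    .of_bound (by fun_prop) 1 (.of_forall fun u => by simpa using hc0 u)
  have hintk (k : κ) := hint (c := fun u => (∑ i, B k i * u i) ^ 2 / (2 * (s k * v)))
    (by fun_prop) fun u => by have := hs0 k; positivity
  have hw1 : ∑ k, s k / T = 1 := by rw [← Finset.sum_div, ← hT, div_self hB.ne']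
  have hjensen (u : ι → ℝ) :
      Real.exp (-((∑ k, (∑ i, B k i * u i) ^ 2) / (2 * (T * v)))) ≤
        ∑ k, s k / T * Real.exp (-((∑ i, B k i * u i) ^ 2 / (2 * (s k * v)))) := by
    have h := convexOn_exp.map_sum_le (t := Finset.univ) (w := fun k => s k / T)
      (p := fun k => -((∑ i, B k i * u i) ^ 2 / (2 * (s k * v))))
      (fun k _ => div_nonneg (hs0 k) hB.le) hw1 (fun _ _ => Set.mem_univ _)
    simp only [smul_eq_mul] at h
    refine (congrArg Real.exp ?_).trans_le h
    rw [Finset.sum_div, ← Finset.sum_neg_distrib]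
    refine Finset.sum_congr rfl fun k _ => ?_
    rcases eq_or_ne (s k) 0 with h0 | h0
    · have hz : ∀ i, B k i = 0 := fun i => by
        simpa using (Finset.sum_eq_zero_iff_of_nonneg fun i _ => sq_nonneg (B k i)).1 h0 i
          (Finset.mem_univ i)
      simp [hz, h0]
    · field_simp
  calc _ ≤ ∫ u, ∑ k, s k / T * Real.exp (-((∑ i, B k i * u i) ^ 2 / (2 * (s k * v))))
        ∂(Measure.pi fun _ : ι => gaussianReal 0 v) := by
        refine integral_mono (hint (by fun_prop) fun u => by positivity) ?_ hjensen
        exact integrable_finsetSum _ fun k _ => (hintk k).const_mul _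
    _ = ∑ k, s k / T * (√2)⁻¹ := by
        rw [integral_finsetSum _ fun k _ => (hintk k).const_mul _]
        refine Finset.sum_congr rfl fun k _ => ?_
        rw [integral_const_mul]
        rcases eq_or_ne (s k) 0 with h0 | h0
        · simp [h0]
        · rw [integral_exp_neg_sq_weighted_sum hv (B k) h0]
    _ = (√2)⁻¹ := by rw [← Finset.sum_mul, hw1, one_mul]

/-- for an `n × n` positive semidefinite matrix `A` with nonzero trace
and `U ∼ N(0,(1/n)I_n)`, for any `α > 0`,
`P[UᵀAU < α·E[UᵀAU]] ≤ e^{−((1/2)−α)/2}`, where `E[UᵀAU] = trace(A)/n`. -/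
theorem quadratic_form_lower_tail {n : ℕ} (hn : 0 < n)
    (A : Matrix (Fin n) (Fin n) ℝ) (hA : A.PosSemidef) (htr : A.trace ≠ 0)
    (α : ℝ) (hα : 0 < α) :
    gaussPi n {u | ∑ i, ∑ j, u i * A i j * u j < α * (A.trace / n)}
      ≤ ENNReal.ofReal (Real.exp (-(1 / 2 - α) / 2)) := by
  have : IsProbabilityMeasure (gaussPi n) := by unfold gaussPi; infer_instance
  have hn' : (0 : ℝ) < n := by exact_mod_cast hn
  have hv : (n : ℝ≥0)⁻¹ ≠ 0 := inv_ne_zero (by exact_mod_cast hn.ne')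
  obtain ⟨B, rfl⟩ : ∃ B : Matrix (Fin n) (Fin n) ℝ, A = Bᵀ * B := by
    open scoped MatrixOrder Matrix.Norms.L2Operator in
    obtain ⟨B, hB⟩ := CStarAlgebra.nonneg_iff_eq_star_mul_self.mp hA.nonneg
    exact ⟨B, by simpa [star_eq_conjTranspose] using hB⟩
  have htrace : (Bᵀ * B).trace = ∑ k, ∑ i, B k i ^ 2 := by
    simp only [trace, diag, mul_apply, transpose_apply, ← sq]
    exact Finset.sum_comm
  have hquad (u : Fin n → ℝ) :
      ∑ i, ∑ j, u i * (Bᵀ * B) i j * u j = ∑ k, (∑ i, B k i * u i) ^ 2 := by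
    simp_rw [sq, Finset.sum_mul_sum, mul_apply, transpose_apply, Finset.mul_sum, Finset.sum_mul]
    rw [Finset.sum_comm (γ := Fin n) (f := fun k i => ∑ j, B k i * u i * (B k j * u j))]
    refine Finset.sum_congr rfl fun i _ => ?_
    rw [Finset.sum_comm]
    exact Finset.sum_congr rfl fun k _ => Finset.sum_congr rfl fun j _ => by ring
  simp_rw [hquad, htrace]
  have hT : 0 < ∑ k, ∑ i, B k i ^ 2 :=
    lt_of_le_of_ne (Finset.sum_nonneg fun k _ => Finset.sum_nonneg fun i _ => sq_nonneg _)
      (htrace ▸ htr.symm)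
  have hexp := integral_exp_neg_sum_sq_le hv B hT
  set T := ∑ k, ∑ i, B k i ^ 2
  have hmarkov := mul_meas_ge_le_integral_of_nonneg (μ := gaussPi n)
    (f := fun u => Real.exp (-((∑ k, (∑ i, B k i * u i) ^ 2) / (2 * (T * (n : ℝ≥0)⁻¹)))))
    (.of_forall fun u => (Real.exp_pos _).le)
    (.of_bound (Measurable.aestronglyMeasurable (by fun_prop)) 1
      (.of_forall fun u => by simp; positivity)) (Real.exp (-(α / 2)))
  rw [← ofReal_measureReal]
  refine ENNReal.ofReal_le_ofReal ?_
  have hsub : {u : Fin n → ℝ | ∑ k, (∑ i, B k i * u i) ^ 2 < α * (T / n)} ⊆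
      {u | Real.exp (-(α / 2)) ≤
        Real.exp (-((∑ k, (∑ i, B k i * u i) ^ 2) / (2 * (T * (n : ℝ≥0)⁻¹))))} := by
    intro u hu
    simp only [Set.mem_ofPred_eq, NNReal.coe_inv, NNReal.coe_natCast] at hu ⊢
    rw [Real.exp_le_exp, neg_le_neg_iff, div_le_iff₀ (by positivity)]
    refine hu.le.trans_eq ?_
    field_simp
  refine (measureReal_mono hsub).trans ?_
  have hbound := (hmarkov.trans hexp).trans inv_sqrt_two_le_exp
  rw [← le_div_iff₀' (Real.exp_pos _), ← Real.exp_sub] at hbound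
  refine hbound.trans_eq ?_
  congr 1
  ring
end

section
/- Let A be an n × n positive semidefinite real matrix with nonzero trace, and let U be a random vector distributed as N(0, (1/n)·I_n). Then for any β > 0, the probability that Uᵀ A U > β · E[Uᵀ A U] is at most e^{−(β − 2)/4}. -/
open MeasureTheory ProbabilityTheory Matrix
open scoped NNReal

/-- A linear form in independent centred Gaussians of variance `v` is a centred Gaussian whose
variance is `v` times the squared Euclidean norm of the coefficients. -/
lemma map_linear_form_pi_gaussianReal {ι : Type*} [Fintype ι] (v : ℝ≥0) (c : ι → ℝ) :
    (Measure.pi fun _ : ι => gaussianReal 0 v).map (fun u => ∑ i, c i * u i)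
      = gaussianReal 0 ((∑ i, c i ^ 2).toNNReal * v) := by
  have hm : Measurable fun u : ι → ℝ => ∑ i, c i * u i := by fun_prop
  have : IsProbabilityMeasure
      ((Measure.pi fun _ : ι => gaussianReal 0 v).map (fun u => ∑ i, c i * u i)) :=
    Measure.isProbabilityMeasure_map hm.aemeasurable
  refine Measure.ext_of_charFun ?_
  ext t
  have hexp (u : ι → ℝ) : Complex.exp (t * ((∑ i, c i * u i : ℝ) : ℂ) * Complex.I)
      = ∏ i, Complex.exp (((t * c i : ℝ) : ℂ) * (u i : ℂ) * Complex.I) := by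
    rw [← Complex.exp_sum]
    push_cast
    simp only [Finset.mul_sum, Finset.sum_mul, mul_assoc]
  have hint (a : ℝ) : ∫ x : ℝ, Complex.exp ((a : ℂ) * (x : ℂ) * Complex.I) ∂gaussianReal 0 v
      = Complex.exp (-(v * a ^ 2 / 2)) := by
    rw [← charFun_apply_real, charFun_gaussianReal]
    simp
  rw [charFun_apply_real, integral_map hm.aemeasurable (by fun_prop)]
  simp_rw [hexp]
  rw [integral_fintype_prod_eq_prod
    (f := fun i (x : ℝ) => Complex.exp (((t * c i : ℝ) : ℂ) * (x : ℂ) * Complex.I))]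
  simp_rw [hint]
  rw [← Complex.exp_sum, charFun_gaussianReal]
  have hnn : 0 ≤ ∑ i, c i ^ 2 := Finset.sum_nonneg fun i _ => sq_nonneg _
  congr 1
  simp only [NNReal.coe_mul, Real.coe_toNNReal _ hnn]
  push_cast
  simp only [mul_zero, zero_mul, zero_sub, Finset.sum_neg_distrib, Finset.sum_mul,
    Finset.sum_div]
  congr 1
  exact Finset.sum_congr rfl fun i _ => by ring

lemma gaussianPDFReal_mul_exp_sq {v w : ℝ≥0} (hv : v ≠ 0) (hw : w ≠ 0) (x : ℝ) :
    gaussianPDFReal 0 v x * Real.exp (x ^ 2 / 2 * ((v : ℝ)⁻¹ - (w : ℝ)⁻¹))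
      = √(w / v) * gaussianPDFReal 0 w x := by
  have hv' : (0 : ℝ) < v := by positivity
  have hw' : (0 : ℝ) < w := by positivity
  have hπ : √(2 * Real.pi) ≠ 0 := by positivity
  have hsv : √(v : ℝ) ≠ 0 := by positivity
  have hsw : √(w : ℝ) ≠ 0 := by positivity
  rw [gaussianPDFReal, gaussianPDFReal, mul_assoc, ← Real.exp_add,
    Real.sqrt_div hw'.le, Real.sqrt_mul (by positivity) (v : ℝ),
    Real.sqrt_mul (by positivity) (w : ℝ)]
  have he : -(x - 0) ^ 2 / (2 * v) + x ^ 2 / 2 * ((v : ℝ)⁻¹ - (w : ℝ)⁻¹)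
      = -(x - 0) ^ 2 / (2 * w) := by
    field_simp
    ring
  rw [he]
  field_simp

/-- The exponential moment of the square of a centred Gaussian variable of variance `v`. -/
lemma lintegral_exp_sq_gaussianReal {v w : ℝ≥0} (hv : v ≠ 0) (hw : w ≠ 0) :
    ∫⁻ x, ENNReal.ofReal (Real.exp (x ^ 2 / 2 * ((v : ℝ)⁻¹ - (w : ℝ)⁻¹))) ∂gaussianReal 0 v
      = ENNReal.ofReal √(w / v) := by
  rw [gaussianReal_of_var_ne_zero _ hv,
    lintegral_withDensity_eq_lintegral_mul _ (measurable_gaussianPDF 0 v) (by fun_prop)]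
  simp only [Pi.mul_apply, gaussianPDF, ← ENNReal.ofReal_mul (gaussianPDFReal_nonneg _ _ _),
    gaussianPDFReal_mul_exp_sq hv hw]
  simp only [ENNReal.ofReal_mul (Real.sqrt_nonneg _)]
  rw [lintegral_const_mul _ (by fun_prop), lintegral_gaussianPDFReal_eq_one _ hw, mul_one]

/-- A real Hermitian quadratic form is diagonal in the eigenbasis. -/
lemma Matrix.IsHermitian.quadratic_form_eq_sum_eigenvalues {ι : Type*} [Fintype ι] [DecidableEq ι]
    {A : Matrix ι ι ℝ} (hA : A.IsHermitian) (u : ι → ℝ) :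
    ∑ i, ∑ j, u i * A i j * u j
      = ∑ k, hA.eigenvalues k * (∑ i, hA.eigenvectorBasis k i * u i) ^ 2 := by
  have hentry (i j : ι) : A i j
      = ∑ k, hA.eigenvectorBasis k i * hA.eigenvalues k * hA.eigenvectorBasis k j := by
    conv_lhs => rw [hA.spectral_theorem]
    simp [Unitary.conjStarAlgAut_apply, Matrix.mul_apply, Matrix.diagonal_apply]
  simp_rw [hentry, sq, Finset.sum_mul_sum, Finset.mul_sum, Finset.sum_mul]
  rw [Finset.sum_comm_cycle]
  refine Finset.sum_congr rfl fun k _ => Finset.sum_congr rfl fun i _ =>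
    Finset.sum_congr rfl fun j _ => by ring

/-- for an `n × n` positive semidefinite matrix `A` with nonzero trace
and `U ∼ N(0,(1/n)I_n)`, for any `β > 0`,
`P[UᵀAU > β·E[UᵀAU]] ≤ e^{−(β−2)/4}`, where `E[UᵀAU] = trace(A)/n`. -/
theorem quadratic_form_upper_tail {n : ℕ} (hn : 0 < n)
    (A : Matrix (Fin n) (Fin n) ℝ) (hA : A.PosSemidef) (htr : A.trace ≠ 0)
    (β : ℝ) (hβ : 0 < β) :
    gaussPi n {u | ∑ i, ∑ j, u i * A i j * u j > β * (A.trace / n)}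
      ≤ ENNReal.ofReal (Real.exp (-(β - 2) / 4)) := by
  have hn' : (0 : ℝ) < n := by exact_mod_cast hn
  have htr' : 0 < A.trace := lt_of_le_of_ne hA.trace_nonneg htr.symm
  set b := hA.isHermitian.eigenvectorBasis
  set w : Fin n → ℝ := fun k => hA.isHermitian.eigenvalues k / A.trace with hw
  have hw0 (k : Fin n) : 0 ≤ w k := div_nonneg (hA.eigenvalues_nonneg k) htr'.le
  have hw1 : ∑ k, w k = 1 := by
    rw [hw, ← Finset.sum_div, div_eq_one_iff_eq htr]
    simpa using hA.isHermitian.trace_eq_sum_eigenvalues.symm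
  set Z : Fin n → (Fin n → ℝ) → ℝ := fun k u => ∑ i, b k i * u i with hZ
  have hZm (k : Fin n) : Measurable (Z k) := by fun_prop
  set f : ℝ → ENNReal := fun x => ENNReal.ofReal (Real.exp (n / 4 * x ^ 2)) with hf
  have hfm : Measurable f := by fun_prop
  have hmoment (k : Fin n) : ∫⁻ u, f (Z k u) ∂gaussPi n = ENNReal.ofReal √2 := by
    have hnorm : ∑ i, b k i ^ 2 = 1 := by
      have := b.orthonormal.1 k
      rw [EuclideanSpace.norm_eq, Real.sqrt_eq_one] at this
      simpa using this
    have hv : ((n : ℝ≥0)⁻¹) ≠ 0 := by positivity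
    have hlaw := map_linear_form_pi_gaussianReal (n : ℝ≥0)⁻¹ (fun i => b k i)
    rw [hnorm, Real.toNNReal_one, one_mul] at hlaw
    rw [← lintegral_map hfm (hZm k), gaussPi, hZ, hlaw]
    convert lintegral_exp_sq_gaussianReal hv (mul_ne_zero two_ne_zero hv) using 4 with x
    · congr 1
      push_cast
      field_simp
      ring
    · push_cast
      field_simp
  have hpoint (u : Fin n → ℝ) (hu : ∑ i, ∑ j, u i * A i j * u j > β * (A.trace / n)) :
      ENNReal.ofReal (Real.exp (β / 4)) ≤ ∑ k, ENNReal.ofReal (w k) * f (Z k u) := by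
    have hjensen := convexOn_exp.map_sum_le (t := Finset.univ) (w := w)
      (p := fun k => n / 4 * Z k u ^ 2) (fun k _ => hw0 k) hw1 (fun _ _ => Set.mem_univ _)
    have hsum : ∑ k, w k * (n / 4 * Z k u ^ 2)
        = n / (4 * A.trace) * ∑ i, ∑ j, u i * A i j * u j := by
      rw [hA.isHermitian.quadratic_form_eq_sum_eigenvalues, Finset.mul_sum]
      refine Finset.sum_congr rfl fun k _ => ?_
      simp only [hw, hZ]
      field_simp
      rfl
    simp only [smul_eq_mul, hsum] at hjensen
    simp only [hf, ← ENNReal.ofReal_mul (hw0 _)]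
    rw [← ENNReal.ofReal_sum_of_nonneg fun k _ => mul_nonneg (hw0 k) (Real.exp_pos _).le]
    refine ENNReal.ofReal_le_ofReal (le_trans (Real.exp_le_exp.2 ?_) hjensen)
    calc β / 4 = n / (4 * A.trace) * (β * (A.trace / n)) := by field_simp
      _ ≤ _ := by gcongr
  have hsqrt : √2 ≤ Real.exp (1 / 2) := by
    refine Real.sqrt_le_iff.2 ⟨(Real.exp_pos _).le, ?_⟩
    rw [← Real.exp_nat_mul]
    norm_num
    linarith [Real.add_one_le_exp (1 : ℝ)]
  calc gaussPi n {u | ∑ i, ∑ j, u i * A i j * u j > β * (A.trace / n)}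
      ≤ gaussPi n {u | ENNReal.ofReal (Real.exp (β / 4))
          ≤ ∑ k, ENNReal.ofReal (w k) * f (Z k u)} := measure_mono hpoint
    _ ≤ (∫⁻ u, ∑ k, ENNReal.ofReal (w k) * f (Z k u) ∂gaussPi n)
          / ENNReal.ofReal (Real.exp (β / 4)) :=
        meas_ge_le_lintegral_div (by fun_prop) (by simp [Real.exp_pos]) ENNReal.ofReal_ne_top
    _ = ENNReal.ofReal √2 / ENNReal.ofReal (Real.exp (β / 4)) := by
        rw [lintegral_finsetSum _ fun k _ => by fun_prop]
        have hterm (k : Fin n) : ∫⁻ u, ENNReal.ofReal (w k) * f (Z k u) ∂gaussPi n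
            = ENNReal.ofReal (w k) * ENNReal.ofReal √2 := by
          rw [lintegral_const_mul _ (by fun_prop), hmoment]
        simp_rw [hterm]
        rw [← Finset.sum_mul, ← ENNReal.ofReal_sum_of_nonneg fun k _ => hw0 k, hw1,
          ENNReal.ofReal_one, one_mul]
    _ = ENNReal.ofReal (√2 / Real.exp (β / 4)) :=
        (ENNReal.ofReal_div_of_pos (Real.exp_pos _)).symm
    _ ≤ ENNReal.ofReal (Real.exp (-(β - 2) / 4)) := by
        refine ENNReal.ofReal_le_ofReal ?_
        rwa [div_le_iff₀ (Real.exp_pos _), ← Real.exp_add,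
          show -(β - 2) / 4 + β / 4 = 1 / 2 by ring]
end
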